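/- There is no function g : Ω' → [0,1] that tends to 1 at B within Ω' and satisfies the left-distributivity law (x ⊕ y) ⊠ z = (x ⊠ z) ⊕ (y ⊠ z) for all x, y, z ∈ Ω'. -/

import Mathlib

noncomputable section

/-- The opinion space excluding dogmatic opinions. -/
def Omega' : Set (ℝ × ℝ × ℝ) :=
  {x | x.1 ∈ Set.Ico (0:ℝ) 1 ∧ x.2.1 ∈ Set.Ico (0:ℝ) 1 ∧ x.2.2 ∈ Set.Ioc (0:ℝ) 1 ∧
    x.1 + x.2.1 + x.2.2 = 1}

/-- The full uncertainty opinion U = (0,0,1). -/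
def Uop : ℝ × ℝ × ℝ := (0, 0, 1)

/-- The consensus operation ⊕. -/
def consensus (x y : ℝ × ℝ × ℝ) : ℝ × ℝ × ℝ :=
  ((x.2.2 * y.1 + y.2.2 * x.1) / (x.2.2 + y.2.2 - x.2.2 * y.2.2),
   (x.2.2 * y.2.1 + y.2.2 * x.2.1) / (x.2.2 + y.2.2 - x.2.2 * y.2.2),
   x.2.2 * y.2.2 / (x.2.2 + y.2.2 - x.2.2 * y.2.2))

/-- Scalar multiplication α·x of evidence. -/
def smulOp (α : ℝ) (x : ℝ × ℝ × ℝ) : ℝ × ℝ × ℝ :=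
  (α * x.1 / (α * (x.1 + x.2.1) + x.2.2),
   α * x.2.1 / (α * (x.1 + x.2.1) + x.2.2),
   x.2.2 / (α * (x.1 + x.2.1) + x.2.2))

/-- Positive evidence p(x) = c·x_b/x_u. -/
def pEv (c : ℝ) (x : ℝ × ℝ × ℝ) : ℝ := c * x.1 / x.2.2

/-- Negative evidence n(x) = c·x_d/x_u. -/
def nEv (c : ℝ) (x : ℝ × ℝ × ℝ) : ℝ := c * x.2.1 / x.2.2

/-- The new discounting rule x ⊠ y = g(x)·y. -/
def box (g : ℝ × ℝ × ℝ → ℝ) (x y : ℝ × ℝ × ℝ) : ℝ × ℝ × ℝ := smulOp (g x) y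

/-- Subjective Logic discounting x ⊗ y. -/
def otimesSL (x y : ℝ × ℝ × ℝ) : ℝ × ℝ × ℝ :=
  (x.1 * y.1, x.1 * y.2.1, x.2.1 + x.2.2 + x.1 * y.2.2)

/-- Full belief B = (1,0,0). -/
def Bop : ℝ × ℝ × ℝ := (1, 0, 0)

open Filter Topology

/-- `2b/(1+b) = 1 - u/(2-u)` for `b = 1 - u`: doubling the evidence of a purely positive opinion. -/
theorem consensus_positive_self {u : ℝ} (h₀ : 0 < u) (h₁ : u ≤ 1) :
    consensus (1 - u, 0, u) (1 - u, 0, u) = (1 - u / (2 - u), 0, u / (2 - u)) := by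
  have h₂ : 2 - u ≠ 0 := by linarith
  have h₃ : u + u - u * u = u * (2 - u) := by ring
  simp only [consensus, h₃, Prod.mk.injEq]
  refine ⟨?_, ?_, ?_⟩ <;> field_simp <;> ring

theorem positive_mem_Omega' {u : ℝ} (h₀ : 0 < u) (h₁ : u ≤ 1) : (1 - u, 0, u) ∈ Omega' := by
  refine ⟨⟨?_, ?_⟩, ⟨?_, ?_⟩, ⟨?_, ?_⟩, ?_⟩ <;> norm_num <;> linarith

theorem tendsto_positive_Bop :
    Tendsto (fun u : ℝ => ((1 - u, 0, u) : ℝ × ℝ × ℝ)) (𝓝[>] 0) (𝓝[Omega'] Bop) := by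
  refine tendsto_nhdsWithin_iff.2 ⟨?_, ?_⟩
  · have h : Continuous fun u : ℝ => ((1 - u, 0, u) : ℝ × ℝ × ℝ) := by fun_prop
    have h0 := h.tendsto 0
    rw [sub_zero] at h0
    exact h0.mono_left nhdsWithin_le_nhds
  · filter_upwards [Ioc_mem_nhdsGT (zero_lt_one' ℝ)] with u hu
    exact positive_mem_Omega' hu.1 hu.2

/-- On the opinion `(1/2, 0, 1/2)`, scalar multiplication turns consensus into addition. -/
theorem eq_add_of_smulOp_half_eq_consensus {a b c : ℝ} (ha : 0 ≤ a) (hb : 0 ≤ b) (hc : 0 ≤ c)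
    (h : smulOp c (1 / 2, 0, 1 / 2) =
      consensus (smulOp a (1 / 2, 0, 1 / 2)) (smulOp b (1 / 2, 0, 1 / 2))) : c = a + b := by
  have hu (t : ℝ) (ht : 0 ≤ t) :
      smulOp t (1 / 2, 0, 1 / 2) = (t / (t + 1), 0, 1 / (t + 1)) := by
    have : t + 1 ≠ 0 := by positivity
    simp only [smulOp, Prod.mk.injEq]
    refine ⟨?_, ?_, ?_⟩ <;> field_simp <;> ring
  rw [hu a ha, hu b hb, hu c hc] at h
  have hden : 1 / (a + 1) + 1 / (b + 1) - 1 / (a + 1) * (1 / (b + 1)) =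
      (a + b + 1) / ((a + 1) * (b + 1)) := by
    field_simp
    ring
  have h₃ := congrArg (fun x => x.2.2) h
  simp only [consensus, hden] at h₃
  field_simp at h₃
  linarith

theorem stmt14 :
    ¬ ∃ g : ℝ × ℝ × ℝ → ℝ,
      (∀ x ∈ Omega', g x ∈ Set.Icc (0:ℝ) 1) ∧
      Filter.Tendsto g (nhdsWithin Bop Omega') (nhds 1) ∧
      (∀ x ∈ Omega', ∀ y ∈ Omega', ∀ z ∈ Omega',
        box g (consensus x y) z = consensus (box g x z) (box g y z)) := by
  rintro ⟨g, hg, hlim, hdist⟩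
  have hlarge : ∀ᶠ u : ℝ in 𝓝[>] 0, 1 / 2 < g (1 - u, 0, u) :=
    (hlim.comp tendsto_positive_Bop).eventually (lt_mem_nhds (by norm_num))
  obtain ⟨u, hgu, h₀, h₁⟩ := (hlarge.and (Ioc_mem_nhdsGT (zero_lt_one' ℝ))).exists
  have hx := positive_mem_Omega' h₀ h₁
  have hxx : consensus (1 - u, 0, u) (1 - u, 0, u) ∈ Omega' := by
    rw [consensus_positive_self h₀ h₁]
    exact positive_mem_Omega' (div_pos h₀ (by linarith))
      ((div_le_one (by linarith)).2 (by linarith))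
  have hz : ((1 / 2, 0, 1 / 2) : ℝ × ℝ × ℝ) ∈ Omega' := by
    norm_num [Omega']
  have hadd := eq_add_of_smulOp_half_eq_consensus (hg _ hx).1 (hg _ hx).1 (hg _ hxx).1
    (hdist _ hx _ hx _ hz)
  linarith [(hg _ hxx).2]
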